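/- Let Γ be a group generated by a finite set X, let N ◁ Γ be an abelian normal subgroup, and suppose the quotient Γ/N is amenable. Then Γ is amenable and its Følner function satisfies F_{Γ,X}(n) ≤ F_{Γ/N}(2n) · (2n F_{Γ/N}(2n)²)^{|X| F_{Γ/N}(2n)²} for all n ≥ 1, where F_{Γ/N} is the Følner function of Γ/N with respect to the generating set ρ(X) and ρ : Γ → Γ/N is the canonical projection. -/

import Mathlib

open scoped Pointwise

variable {G : Type*} [Group G] [DecidableEq G]

/-- `F` is an `n`-Følner set for the group generated by `X`. -/
def IsFolner (X : Finset G) (n : ℕ) (F : Finset G) : Prop :=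
  F.Nonempty ∧ ∀ x ∈ X, ((F \ F.image (x * ·)).card : ℚ) / F.card ≤ 1 / n

/-- Word length with respect to `X ∪ X⁻¹`. -/
noncomputable def wordLength (X : Set G) (g : G) : ℕ :=
  sInf {k | ∃ w : List G, (∀ a ∈ w, a ∈ X ∨ a⁻¹ ∈ X) ∧ w.length = k ∧ w.prod = g}

/-- The Følner function. -/
noncomputable def folnerFn (X : Finset G) (n : ℕ) : ℕ :=
  sInf {k | ∃ F : Finset G, IsFolner X n F ∧ F.card = k}

/-- `C_n(y₁,…,y_s)`. -/
def Cube (n : ℕ) {s : ℕ} (y : Fin s → G) : Finset G :=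
  Finset.image (fun i : Fin s → Fin n => (List.ofFn fun j => y j ^ (i j : ℕ)).prod) Finset.univ

noncomputable def distortion (X Y : Finset G) (N : Subgroup G) (m : ℕ) : ℕ :=
  sSup {k | ∃ ω ∈ N, wordLength (X : Set G) ω ≤ m ∧ wordLength (Y : Set G) ω = k}

theorem isFolner_iff {G : Type*} [Group G] [DecidableEq G] {X F : Finset G} {n : ℕ} (hn : 1 ≤ n) :
    IsFolner X n F ↔
      F.Nonempty ∧ ∀ x ∈ X, n * (F \ F.image (x * ·)).card ≤ F.card := by
  refine and_congr_right fun hF => forall₂_congr fun x _ => ?_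
  have hc : (0 : ℚ) < F.card := by exact_mod_cast hF.card_pos
  have hn' : (0 : ℚ) < n := by exact_mod_cast hn
  rw [div_le_div_iff₀ hc hn', one_mul, mul_comm]
  exact_mod_cast Iff.rfl

/-- A finite set that is a union of progressions `b, by, …, by^(m-1)` is almost invariant
under `y`. -/
theorem mul_card_sdiff_image_le {H : Type*} [CommGroup H] [DecidableEq H] (B : Finset H) (y : H)
    (m : ℕ) :
    m * ((B * (Finset.range m).image (y ^ ·)) \
      (B * (Finset.range m).image (y ^ ·)).image (y * ·)).card ≤
        (B * (Finset.range m).image (y ^ ·)).card := by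
  set A := B * (Finset.range m).image (y ^ ·) with hA
  have hmem : ∀ a, a ∈ A ↔ ∃ b ∈ B, ∃ i < m, b * y ^ i = a := by
    intro a
    simp [hA, Finset.mem_mul]
  have hstart : ∀ a ∈ A \ A.image (y * ·), a ∈ B := by
    intro a ha
    obtain ⟨haA, hay⟩ := Finset.mem_sdiff.1 ha
    obtain ⟨b, hb, i, hi, rfl⟩ := (hmem a).1 haA
    cases i with
    | zero => simpa using hb
    | succ i =>
      refine absurd (Finset.mem_image.2 ⟨b * y ^ i, (hmem _).2 ⟨b, hb, i, by lia, rfl⟩, ?_⟩) hay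
      rw [pow_succ', mul_left_comm]
  have hle : ∀ a ∈ A \ A.image (y * ·), ∀ a' ∈ A \ A.image (y * ·), ∀ i j, i ≤ j → j < m →
      a * y ^ i = a' * y ^ j → a = a' ∧ i = j := by
    intro a ha a' ha' i j hij hj h
    obtain ⟨d, rfl⟩ := Nat.exists_eq_add_of_le hij
    have h1 : a = a' * y ^ d := by
      rw [add_comm, pow_add, ← mul_assoc] at h
      exact mul_right_cancel h
    cases d with
    | zero => simpa using h1
    | succ d =>
      refine absurd (Finset.mem_image.2 ⟨a' * y ^ d,
        (hmem _).2 ⟨a', hstart a' ha', d, by lia, rfl⟩, ?_⟩) (Finset.mem_sdiff.1 ha).2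
      rw [h1, pow_succ', mul_left_comm]
  rw [mul_comm]
  nth_rw 1 [← Finset.card_range m]
  rw [← Finset.card_product]
  refine Finset.card_le_card_of_injOn (fun p => p.1 * y ^ p.2) ?_ ?_
  · rintro ⟨a, i⟩ hp
    obtain ⟨ha, hi⟩ := Finset.mem_product.1 hp
    exact (hmem _).2 ⟨a, hstart a ha, i, Finset.mem_range.1 hi, rfl⟩
  · rintro ⟨a, i⟩ hp ⟨a', j⟩ hq h
    obtain ⟨ha, hi⟩ := Finset.mem_product.1 hp
    obtain ⟨ha', hj⟩ := Finset.mem_product.1 hq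
    rw [Finset.mem_range] at hi hj
    rcases le_total i j with hij | hij
    · obtain ⟨h1, h2⟩ := hle a ha a' ha' i j hij hj h
      exact Prod.ext h1 h2
    · obtain ⟨h1, h2⟩ := hle a' ha' a ha j i hij hi h.symm
      exact Prod.ext h1.symm h2.symm

/-- In an abelian group, every finite set `Y` admits an `m`-Følner set of size at most
`m ^ |Y|`. -/
theorem exists_isFolner_of_commGroup {H : Type*} [CommGroup H] [DecidableEq H] (Y : Finset H)
    {m : ℕ} (hm : 1 ≤ m) : ∃ A : Finset H, IsFolner Y m A ∧ A.card ≤ m ^ Y.card := by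
  refine ⟨∏ y ∈ Y, (Finset.range m).image (y ^ ·), (isFolner_iff hm).2 ⟨?_, ?_⟩, ?_⟩
  · induction Y using Finset.induction_on with
    | empty => simp
    | insert a s ha ih =>
      rw [Finset.prod_insert ha]
      exact (((Finset.nonempty_range_iff.2 (by lia)).image _)).mul ih
  · intro y hy
    rw [← Finset.prod_erase_mul _ _ hy]
    exact mul_card_sdiff_image_le _ _ _
  · induction Y using Finset.induction_on with
    | empty => simp
    | insert a s ha ih =>
      rw [Finset.prod_insert ha, Finset.card_insert_of_notMem ha, pow_succ']
      refine Finset.card_mul_le.trans (Nat.mul_le_mul ?_ ih)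
      exact Finset.card_image_le.trans (Finset.card_range m).le

/-- A Følner set of `G` is obtained from one of `G ⧸ N` and one of the abelian subgroup `N`. -/
theorem exists_isFolner_of_quotient {G : Type*} [Group G] [DecidableEq G] (X : Finset G)
    (N : Subgroup G) [N.Normal] (hab : ∀ a ∈ N, ∀ b ∈ N, Commute a b) [DecidableEq (G ⧸ N)]
    {n : ℕ} (hn : 1 ≤ n) {K : Finset (G ⧸ N)}
    (hK : IsFolner (X.image (QuotientGroup.mk' N)) (2 * n) K) :
    ∃ F : Finset G, IsFolner X n F ∧ F.card ≤ K.card * (2 * n) ^ (X.card * K.card) := by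
  have h2n : 1 ≤ 2 * n := by lia
  let _ : CommGroup N := { (inferInstance : Group N) with
    mul_comm := fun a b => Subtype.ext (hab a a.2 b b.2) }
  -- the cocycle of the section `Quotient.out`
  let c : G → G ⧸ N → N := fun x u => ⟨(QuotientGroup.mk x * u).out⁻¹ * (x * u.out), by
    rw [← QuotientGroup.eq, QuotientGroup.mk_mul, QuotientGroup.out_eq', QuotientGroup.out_eq']⟩
  have hc : ∀ (x : G) (u : G ⧸ N), ((x : G ⧸ N) * u).out * (c x u : G) = x * u.out := fun x u => by simp [c]
  obtain ⟨A, hA, hAcard⟩ := exists_isFolner_of_commGroup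
    ((X ×ˢ K).image fun p => c p.1 p.2) h2n
  rw [isFolner_iff h2n] at hA hK
  obtain ⟨hAne, hA⟩ := hA
  obtain ⟨hKne, hK⟩ := hK
  let f : (G ⧸ N) × N → G := fun p => p.1.out * p.2
  have hf : Function.Injective f := by
    rintro ⟨u, a⟩ ⟨v, b⟩ h
    have h' : u.out * (a : G) = v.out * b := h
    have huv : u = v := by
      have := congrArg (QuotientGroup.mk (s := N)) h'
      rwa [QuotientGroup.mk_mul_of_mem _ a.2, QuotientGroup.mk_mul_of_mem _ b.2,
        QuotientGroup.out_eq', QuotientGroup.out_eq'] at this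
    subst huv
    exact Prod.ext rfl (Subtype.ext (mul_left_cancel h'))
  have hFcard : ((K ×ˢ A).image f).card = K.card * A.card := by
    rw [Finset.card_image_of_injective _ hf, Finset.card_product]
  refine ⟨(K ×ˢ A).image f, (isFolner_iff hn).2 ⟨(hKne.product hAne).image _, fun x hx => ?_⟩, ?_⟩
  · have hsub : (K ×ˢ A).image f \ ((K ×ˢ A).image f).image (x * ·) ⊆
        ((K \ K.image ((x : G ⧸ N) * ·)) ×ˢ A).image f ∪
          K.biUnion fun u => (A \ A.image (c x u * ·)).image fun a => f ((x : G ⧸ N) * u, a) := by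
      intro g hg
      obtain ⟨hg, hgx⟩ := Finset.mem_sdiff.1 hg
      obtain ⟨⟨v, a⟩, hva, rfl⟩ := Finset.mem_image.1 hg
      obtain ⟨hv, ha⟩ := Finset.mem_product.1 hva
      by_cases hvx : v ∈ K.image ((x : G ⧸ N) * ·)
      · obtain ⟨u, hu, rfl⟩ := Finset.mem_image.1 hvx
        refine Finset.mem_union_right _ (Finset.mem_biUnion.2 ⟨u, hu, Finset.mem_image.2
          ⟨a, Finset.mem_sdiff.2 ⟨ha, fun hac => hgx ?_⟩, rfl⟩⟩)
        obtain ⟨b, hb, rfl⟩ := Finset.mem_image.1 hac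
        refine Finset.mem_image.2 ⟨f (u, b), Finset.mem_image_of_mem _
          (Finset.mem_product.2 ⟨hu, hb⟩), ?_⟩
        change x * (u.out * (b : G)) = ((x : G ⧸ N) * u).out * ((c x u : G) * b)
        rw [← mul_assoc, ← mul_assoc, hc]
      · exact Finset.mem_union_left _ (Finset.mem_image_of_mem _
          (Finset.mem_product.2 ⟨Finset.mem_sdiff.2 ⟨hv, hvx⟩, ha⟩))
    have h1 : 2 * n * (((K \ K.image ((x : G ⧸ N) * ·)) ×ˢ A).image f).card ≤
        K.card * A.card := by
      rw [Finset.card_image_of_injective _ hf, Finset.card_product, ← mul_assoc]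
      exact Nat.mul_le_mul_right _ (hK _ (Finset.mem_image_of_mem _ hx))
    have h2 : 2 * n * (K.biUnion fun u =>
        (A \ A.image (c x u * ·)).image fun a => f ((x : G ⧸ N) * u, a)).card ≤
        K.card * A.card := by
      refine (Nat.mul_le_mul_left _ Finset.card_biUnion_le).trans ?_
      rw [Finset.mul_sum, ← smul_eq_mul]
      refine Finset.sum_le_card_nsmul _ _ _ fun u hu => ?_
      refine (Nat.mul_le_mul_left _ Finset.card_image_le).trans (hA _ ?_)
      exact Finset.mem_image.2 ⟨(x, u), Finset.mem_product.2 ⟨hx, hu⟩, rfl⟩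
    have h3 := (Finset.card_le_card hsub).trans (Finset.card_union_le _ _)
    rw [hFcard]
    nlinarith [Nat.mul_le_mul_left (2 * n) h3]
  · rw [hFcard]
    refine Nat.mul_le_mul_left _ (hAcard.trans (Nat.pow_le_pow_right h2n ?_))
    exact Finset.card_image_le.trans (Finset.card_product _ _).le

/-- If `N ◁ Γ` is abelian and `Γ/N` is amenable, then `Γ` is amenable and
`F_Γ(n) ≤ F_{Γ/N}(2n) · (2n·F_{Γ/N}(2n)²)^(|X|·F_{Γ/N}(2n)²)`. -/
theorem folnerFn_abelian_extension {G : Type*} [Group G] [DecidableEq G]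
    (X : Finset G) (hX : Subgroup.closure (X : Set G) = ⊤)
    (N : Subgroup G) [N.Normal]
    (hab : ∀ a ∈ N, ∀ b ∈ N, Commute a b)
    [DecidableEq (G ⧸ N)]
    (hK : ∀ m : ℕ, 1 ≤ m →
      ∃ F : Finset (G ⧸ N), IsFolner (X.image (QuotientGroup.mk' N)) m F) :
    (∀ m : ℕ, 1 ≤ m → ∃ F : Finset G, IsFolner X m F) ∧
    ∀ n : ℕ, 1 ≤ n →
      folnerFn X n ≤
        folnerFn (X.image (QuotientGroup.mk' N)) (2 * n) *
          (2 * n * (folnerFn (X.image (QuotientGroup.mk' N)) (2 * n)) ^ 2) ^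
            (X.card * (folnerFn (X.image (QuotientGroup.mk' N)) (2 * n)) ^ 2) := by
  refine ⟨fun m hm => ?_, fun n hn => ?_⟩
  · obtain ⟨K, hKF⟩ := hK (2 * m) (by lia)
    obtain ⟨F, hF, -⟩ := exists_isFolner_of_quotient X N hab hm hKF
    exact ⟨F, hF⟩
  · obtain ⟨K, hKF, hcard⟩ : ∃ K, IsFolner (X.image (QuotientGroup.mk' N)) (2 * n) K ∧
        K.card = folnerFn (X.image (QuotientGroup.mk' N)) (2 * n) := by
      obtain ⟨K, hKF⟩ := hK (2 * n) (by lia)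
      exact Nat.sInf_mem (s := {k | ∃ F, IsFolner (X.image (QuotientGroup.mk' N)) (2 * n) F ∧
        F.card = k}) ⟨_, K, hKF, rfl⟩
    obtain ⟨F, hF, hFcard⟩ := exists_isFolner_of_quotient X N hab hn hKF
    rw [← hcard]
    have hpos : 1 ≤ K.card := hKF.1.card_pos
    have hsq : K.card ≤ K.card ^ 2 := Nat.le_self_pow two_ne_zero _
    calc folnerFn X n ≤ F.card := Nat.sInf_le ⟨F, hF, rfl⟩
      _ ≤ K.card * (2 * n) ^ (X.card * K.card) := hFcard
      _ ≤ K.card * (2 * n * K.card ^ 2) ^ (X.card * K.card) :=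
        Nat.mul_le_mul_left _ (Nat.pow_le_pow_left (Nat.le_mul_of_pos_right _ (by positivity)) _)
      _ ≤ K.card * (2 * n * K.card ^ 2) ^ (X.card * K.card ^ 2) :=
        Nat.mul_le_mul_left _ (Nat.pow_le_pow_right (by positivity) (Nat.mul_le_mul_left _ hsq))
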